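/- Let N ≥ 3 be an integer. (i) The family of primitive dual scales {tan(kπ/N)/tan(π/N) : k an integer with 1 ≤ k < N/2 and gcd(k, N) = 1} is linearly independent over ℚ as a family of real numbers. (ii) For every integer j with 1 ≤ j < N/2, the dual scale tan(jπ/N)/tan(π/N) lies in the ℚ-linear span of the primitive dual scales. -/

import Mathlib

open Complex Filter Topology

lemma abs_rpow_neg_sub_rpow_neg_le {n x y s : ℝ} (hn : 1 ≤ n) (hx : x ∈ Set.Icc n (n + 1))
    (hy : y ∈ Set.Icc n (n + 1)) (hs : s ∈ Set.Icc (1 : ℝ) 2) :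
    |x ^ (-s) - y ^ (-s)| ≤ 2 / n ^ 2 := by
  obtain ⟨hs1, hs2⟩ := hs
  have hn0 : 0 < n := by linarith
  have anti {u v : ℝ} (hu : 0 < u) (huv : u ≤ v) : v ^ (-s) ≤ u ^ (-s) :=
    Real.rpow_le_rpow_of_nonpos hu huv (by linarith)
  have hx1 := anti hn0 hx.1
  have hx2 := anti (hn0.trans_le hx.1) hx.2
  have hy1 := anti hn0 hy.1
  have hy2 := anti (hn0.trans_le hy.1) hy.2
  have hq : (n / (n + 1)) ^ (2 : ℝ) ≤ (n / (n + 1)) ^ s :=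
    Real.rpow_le_rpow_of_exponent_ge (by positivity) (by rw [div_le_one] <;> linarith) hs2
  have hs0 : n ^ (-s) ≤ n⁻¹ := by
    rw [← Real.rpow_neg_one]
    exact Real.rpow_le_rpow_of_exponent_le hn (by linarith)
  have hmul : (n + 1) ^ (-s) = n ^ (-s) * (n / (n + 1)) ^ s := by
    rw [Real.div_rpow hn0.le (by linarith), Real.rpow_neg hn0.le, Real.rpow_neg (by linarith)]
    have := Real.rpow_pos_of_pos hn0 s
    field_simp
  rw [Real.rpow_two] at hq
  have hq1 : (n / (n + 1)) ^ 2 ≤ 1 :=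
    pow_le_one₀ (by positivity) (by rw [div_le_one] <;> linarith)
  calc |x ^ (-s) - y ^ (-s)| ≤ n ^ (-s) - (n + 1) ^ (-s) := by
        rw [abs_sub_le_iff]; constructor <;> linarith
    _ = n ^ (-s) * (1 - (n / (n + 1)) ^ s) := by rw [hmul]; ring
    _ ≤ n ^ (-s) * (1 - (n / (n + 1)) ^ 2) := by
        gcongr
    _ ≤ n⁻¹ * (1 - (n / (n + 1)) ^ 2) := by
        gcongr
    _ ≤ 2 / n ^ 2 := by
        rw [div_pow, one_sub_div (by positivity), ← one_div, div_mul_div_comm,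
          div_le_div_iff₀ (by positivity) (by positivity)]
        nlinarith [mul_pos hn0 hn0, mul_pos (mul_pos hn0 hn0) hn0]

lemma exists_summable_bound_rpow_sub {a : ℝ} (ha : a ∈ Set.Ioo (0 : ℝ) 1) :
    ∃ b : ℕ → ℝ, Summable b ∧ ∀ s ∈ Set.Icc (1 : ℝ) 2, ∀ n : ℕ,
      |(n + a) ^ (-s) - (n + 1 - a) ^ (-s)| ≤ b n := by
  obtain ⟨ha0, ha1⟩ := ha
  refine ⟨fun n ↦ 2 / (n : ℝ) ^ 2 + Pi.single (M := fun _ ↦ ℝ) 0 (a⁻¹ ^ 2 + (1 - a)⁻¹ ^ 2) n,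
    ?_, fun s hs n ↦ ?_⟩
  · refine .add ?_ (hasSum_pi_single 0 _).summable
    simpa [div_eq_mul_inv] using (Real.summable_nat_pow_inv.mpr one_lt_two).mul_left 2
  · rcases Nat.eq_zero_or_pos n with rfl | hn
    · have aux {u : ℝ} (hu0 : 0 < u) (hu1 : u < 1) : 0 ≤ u ^ (-s) ∧ u ^ (-s) ≤ u⁻¹ ^ 2 := by
        refine ⟨by positivity, ?_⟩
        rw [← Real.rpow_two, Real.inv_rpow hu0.le, ← Real.rpow_neg hu0.le]
        exact Real.rpow_le_rpow_of_exponent_ge hu0 hu1.le (by linarith [hs.2])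
      have h1 := aux ha0 ha1
      have h2 := aux (u := 1 - a) (by linarith) (by linarith)
      simp only [Nat.cast_zero, zero_add, Pi.single_eq_same]
      rw [abs_sub_le_iff]
      norm_num
      constructor <;> simp only [inv_pow] at h1 h2 <;> linarith
    · simp only [Pi.single_eq_of_ne hn.ne', add_zero]
      refine abs_rpow_neg_sub_rpow_neg_le (by exact_mod_cast hn) ?_ ?_ hs <;>
        constructor <;> linarith

/-- Mittag-Leffler expansion of the cotangent, with terms paired as in the odd Hurwitz zeta
function. -/
lemma hasSum_cot {a : ℝ} (ha : a ∈ Set.Ioo (0 : ℝ) 1) :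
    HasSum (fun n : ℕ ↦ (n + a)⁻¹ - (n + 1 - a)⁻¹) (Real.pi * Real.cot (Real.pi * a)) := by
  have hmem : (a : ℂ) ∈ Complex.integerComplement := by
    rintro ⟨m, hm⟩
    have hm' : (m : ℝ) = a := by exact_mod_cast hm
    have h0 : (0 : ℝ) < m := hm' ▸ ha.1
    have h1 : (m : ℝ) < 1 := hm' ▸ ha.2
    norm_cast at h0 h1
    lia
  obtain ⟨b, hb, hle⟩ := exists_summable_bound_rpow_sub ha
  have hsum : Summable (fun n : ℕ ↦ (n + a)⁻¹ - (n + 1 - a)⁻¹) :=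
    .of_norm_bounded hb fun n ↦ by
      simpa [Real.rpow_neg_one] using hle 1 (by simp) n
  rw [hsum.hasSum_iff_tendsto_nat]
  have hser : HasSum (fun n : ℕ ↦ (a - (n + 1))⁻¹ + (a + (n + 1))⁻¹)
      (Real.pi * Real.cot (Real.pi * a) - 1 / a) := by
    rw [← Complex.hasSum_ofReal]
    have := (summable_cotTerm hmem).hasSum
    have e : ∑' n, cotTerm (a : ℂ) n = _ := (cot_series_rep' hmem).symm
    rw [e] at this
    simpa [cotTerm] using this
  have hlim : Tendsto (fun m : ℕ ↦ (a + m)⁻¹) atTop (𝓝 0) :=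
    (tendsto_atTop_add_const_left _ a tendsto_natCast_atTop_atTop).inv_tendsto_atTop
  have := (hser.tendsto_sum_nat.const_add (1 / a)).sub hlim
  rw [add_sub_cancel, sub_zero] at this
  refine this.congr fun m ↦ ?_
  induction m with
  | zero => simp
  | succ m ih =>
    rw [Finset.sum_range_succ, Finset.sum_range_succ, ← ih]
    have : (a - (m + 1))⁻¹ = -(m + 1 - a)⁻¹ := by rw [← inv_neg]; ring_nf
    rw [this]
    push_cast
    ring_nf

/-- The value at `s = 1` of the odd Hurwitz zeta function. -/
lemma hurwitzZetaOdd_one {a : ℝ} (ha : a ∈ Set.Ioo (0 : ℝ) 1) :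
    HurwitzZeta.hurwitzZetaOdd a 1 = ((Real.pi / 2 * Real.cot (Real.pi * a) : ℝ) : ℂ) := by
  obtain ⟨b, hb, hle⟩ := exists_summable_bound_rpow_sub ha
  have hlim : Tendsto (fun s : ℝ ↦ ∑' n : ℕ, ((n + a) ^ (-s) - (n + 1 - a) ^ (-s))) (𝓝[>] 1)
      (𝓝 (∑' n : ℕ, ((n + a)⁻¹ - (n + 1 - a)⁻¹))) := by
    refine tendsto_tsum_of_dominated_convergence hb (fun n ↦ ?_) ?_
    · have key {u : ℝ} (hu : 0 < u) : Tendsto (fun s : ℝ ↦ u ^ (-s)) (𝓝[>] 1) (𝓝 u⁻¹) := by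
        rw [← Real.rpow_neg_one u]
        refine ((Real.continuousAt_const_rpow hu.ne').tendsto.comp
          (continuous_neg.tendsto (1 : ℝ))).mono_left nhdsWithin_le_nhds
      have h1 := ha.1
      have h2 := sub_pos.mpr ha.2
      refine (key (by positivity)).sub (key ?_)
      rw [add_sub_assoc]
      positivity
    · filter_upwards [Ioo_mem_nhdsGT (one_lt_two : (1 : ℝ) < 2)] with s hs n
      exact hle s ⟨hs.1.le, hs.2.le⟩ n
  rw [(hasSum_cot ha).tsum_eq] at hlim
  have hcont : Tendsto (fun s : ℝ ↦ HurwitzZeta.hurwitzZetaOdd a s) (𝓝[>] 1)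
      (𝓝 (HurwitzZeta.hurwitzZetaOdd a 1)) := by
    have := ((HurwitzZeta.differentiable_hurwitzZetaOdd a).continuous.comp
      Complex.continuous_ofReal).tendsto 1
    simpa [Function.comp_def] using this.mono_left nhdsWithin_le_nhds
  refine tendsto_nhds_unique hcont ?_
  rw [show Real.pi / 2 * Real.cot (Real.pi * a) = Real.pi * Real.cot (Real.pi * a) / 2 by ring]
  refine ((Complex.continuous_ofReal.tendsto _).comp (hlim.div_const 2)).congr' ?_
  filter_upwards [self_mem_nhdsWithin] with s hs
  rw [← (HurwitzZeta.hasSum_nat_hurwitzZetaOdd_of_mem_Icc ⟨ha.1.le, ha.2.le⟩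
    (by simpa using hs : 1 < (s : ℂ).re)).tsum_eq, tsum_div_const]
  simp only [Function.comp_apply]
  push_cast
  congr 2
  ext n
  have h1 := ha.1
  have h2 := sub_pos.mpr ha.2
  rw [Complex.ofReal_cpow (by positivity), Complex.ofReal_cpow (by rw [add_sub_assoc]; positivity)]
  push_cast
  simp [Complex.cpow_neg]

/-- The cotangent `cot (π x / M)`, as a complex-valued function of the residue `x` modulo `M`;
its value at `0` is `0`. -/
noncomputable def zmodCot {M : ℕ} [NeZero M] (x : ZMod M) : ℂ :=
  I * ((ZMod.stdAddChar x + 1) / (ZMod.stdAddChar x - 1))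

section zmodCot

variable {M : ℕ} [NeZero M]

lemma zmodCot_natCast (k : ℕ) :
    zmodCot (k : ZMod M) = (Real.cot (Real.pi * (k / M)) : ℂ) := by
  have h : ZMod.stdAddChar (k : ZMod M) = cexp (2 * I * (Real.pi * (k / M))) := by
    have := ZMod.stdAddChar_coe (N := M) k
    push_cast at this
    rw [this]
    ring_nf
  rw [zmodCot, h]
  push_cast
  rw [Complex.cot_eq_exp_ratio, ← neg_sub (cexp _), mul_neg, div_neg, ← div_div,
    div_right_comm _ I, Complex.div_I]
  ring

lemma hurwitzZetaOdd_toAddCircle_one (j : ZMod M) :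
    HurwitzZeta.hurwitzZetaOdd (ZMod.toAddCircle j) 1 = Real.pi / 2 * zmodCot j := by
  rcases eq_or_ne j 0 with rfl | hj
  · have := HurwitzZeta.hurwitzZetaOdd_neg 0 1
    rw [neg_zero, self_eq_neg] at this
    simp [zmodCot, this]
  · have hM : (0 : ℝ) < M := Nat.cast_pos.mpr (NeZero.pos M)
    have hj0 : (0 : ℝ) < j.val := Nat.cast_pos.mpr ((ZMod.val_pos).mpr hj)
    have hjM : (j.val : ℝ) < M := Nat.cast_lt.mpr (ZMod.val_lt j)
    rw [ZMod.toAddCircle_apply, hurwitzZetaOdd_one ⟨by positivity, (div_lt_one hM).mpr hjM⟩]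
    nth_rewrite 2 [← ZMod.natCast_zmod_val j]
    rw [zmodCot_natCast]
    push_cast
    ring

lemma sum_char_mul_zmodCot_ne_zero {χ : DirichletCharacter ℂ M} (hχ : χ.Odd) :
    ∑ j, χ j * zmodCot j ≠ 0 := by
  intro h
  have hχ1 : χ ≠ 1 := by
    rintro rfl
    have h1 : (1 : DirichletCharacter ℂ M) (-1) = -1 := hχ
    rw [MulChar.one_apply isUnit_one.neg] at h1
    norm_num at h1
  refine DirichletCharacter.LFunction_apply_one_ne_zero hχ1 ?_
  rw [DirichletCharacter.LFunction, ZMod.LFunction_def_odd hχ.to_fun]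
  simp_rw [hurwitzZetaOdd_toAddCircle_one, mul_left_comm (χ _), ← Finset.mul_sum, h, mul_zero]

lemma isPrimitiveRoot_stdAddChar_one : IsPrimitiveRoot (ZMod.stdAddChar (1 : ZMod M)) M := by
  have := ZMod.stdAddChar_coe (N := M) 1
  simp only [Int.cast_one, mul_one] at this
  exact this ▸ Complex.isPrimitiveRoot_exp M (NeZero.ne M)

lemma stdAddChar_one_pow (x : ZMod M) :
    ZMod.stdAddChar (1 : ZMod M) ^ x.val = ZMod.stdAddChar x := by
  rw [← AddChar.map_nsmul_eq_pow]
  simp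

/-- Rational linear relations between cotangents are stable under the Galois action. -/
lemma sum_zmodCot_mul_eq_zero {ι : Type*} [Fintype ι] {v : ι → ZMod M} {c : ι → ℚ}
    (h : ∑ i, (c i : ℂ) * zmodCot (v i) = 0) {u : ZMod M} (hu : IsUnit u) :
    ∑ i, (c i : ℂ) * zmodCot (u * v i) = 0 := by
  set ζ : ℂ := ZMod.stdAddChar (1 : ZMod M) with hζ
  have hprim : IsPrimitiveRoot ζ M := isPrimitiveRoot_stdAddChar_one
  have hint : IsIntegral ℚ ζ := (hprim.isIntegral (NeZero.pos M)).tower_top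
  have hcop : u.val.Coprime M := by
    rw [← ZMod.isUnit_iff_coprime, ZMod.natCast_zmod_val]
    exact hu
  have haeval : Polynomial.aeval (ζ ^ u.val) (minpoly ℚ ζ) = 0 := by
    rw [← Polynomial.cyclotomic_eq_minpoly_rat hprim (NeZero.pos M),
      Polynomial.cyclotomic_eq_minpoly_rat (hprim.pow_of_coprime _ hcop) (NeZero.pos M),
      minpoly.aeval]
  obtain ⟨σ, hσ⟩ := IntermediateField.exists_algHom_adjoin_of_splits_of_aeval (F := ℚ) (S := {ζ})
    (fun s hs ↦ by
      rw [Set.mem_singleton_iff.mp hs]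
      exact ⟨hint, IsAlgClosed.splits _⟩)
    (IntermediateField.mem_adjoin_simple_self ℚ ζ) haeval
  set g : IntermediateField.adjoin ℚ {ζ} := ⟨ζ, IntermediateField.mem_adjoin_simple_self ℚ ζ⟩
  have hK : ∑ i, (c i : IntermediateField.adjoin ℚ {ζ}) *
      ((g ^ (v i).val + 1) / (g ^ (v i).val - 1)) = 0 := by
    rw [← (algebraMap (IntermediateField.adjoin ℚ {ζ}) ℂ).injective.eq_iff, map_zero, map_sum]
    have hg : algebraMap (IntermediateField.adjoin ℚ {ζ}) ℂ g = ζ := rfl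
    simp only [map_mul, map_div₀, map_add, map_sub, map_pow, map_one, map_ratCast, hg, hζ,
      stdAddChar_one_pow]
    simp only [zmodCot, mul_left_comm _ I, ← Finset.mul_sum] at h
    exact (mul_eq_zero.mp h).resolve_left I_ne_zero
  have hpow (x : ZMod M) : (ζ ^ u.val) ^ x.val = ZMod.stdAddChar (u * x) := by
    rw [hζ, stdAddChar_one_pow, ← AddChar.map_nsmul_eq_pow, nsmul_eq_mul, ZMod.natCast_zmod_val,
      mul_comm]
  have := congrArg σ hK
  simp only [map_sum, map_mul, map_div₀, map_add, map_sub, map_pow, map_one, map_ratCast, hσ,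
    map_zero, hpow] at this
  simp only [zmodCot, mul_left_comm _ I, ← Finset.mul_sum, this, mul_zero]

/-- A rational relation between cotangents at units annihilates every odd character. -/
lemma sum_char_inv_eq_zero {ι : Type*} [Fintype ι] {v : ι → ZMod M} (hv : ∀ i, IsUnit (v i))
    {c : ι → ℚ} (h : ∑ i, (c i : ℂ) * zmodCot (v i) = 0)
    {χ : DirichletCharacter ℂ M} (hχ : χ.Odd) :
    ∑ i, (c i : ℂ) * χ (v i)⁻¹ = 0 := by
  have hshift (i : ι) : ∑ u, χ u * zmodCot (u * v i) = χ (v i)⁻¹ * ∑ u, χ u * zmodCot u := by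
    rw [Finset.mul_sum]
    refine Fintype.sum_equiv (hv i).unit.mulRight _ _ fun u ↦ ?_
    rw [Units.mulRight_apply, IsUnit.unit_spec, ← mul_assoc, ← map_mul, mul_left_comm,
      ZMod.inv_mul_of_unit _ (hv i), mul_one]
  have hzero : ∑ u, χ u * ∑ i, (c i : ℂ) * zmodCot (u * v i) = 0 := by
    refine Finset.sum_eq_zero fun u _ ↦ ?_
    by_cases hu : IsUnit u
    · rw [sum_zmodCot_mul_eq_zero h hu, mul_zero]
    · rw [χ.map_nonunit hu, zero_mul]
  simp_rw [Finset.mul_sum, mul_left_comm (χ _)] at hzero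
  rw [Finset.sum_comm] at hzero
  simp_rw [← Finset.mul_sum, hshift, ← mul_assoc] at hzero
  rw [← Finset.sum_mul] at hzero
  exact (mul_eq_zero.mp hzero).resolve_right (sum_char_mul_zmodCot_ne_zero hχ)

end zmodCot

/-- Cotangents `cot (π k / M)` at distinct `k` coprime to `M` with `0 < k < M / 2` are linearly
independent over `ℚ`. -/
lemma linearIndependent_cot {M : ℕ} {ι : Type*} [Fintype ι] {v : ι → ℕ}
    (hinj : Function.Injective v) (hpos : ∀ i, 0 < v i) (hlt : ∀ i, 2 * v i < M)
    (hcop : ∀ i, (v i).Coprime M) :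
    LinearIndependent ℚ fun i ↦ Real.cot (Real.pi * (v i / M)) := by
  classical
  rw [Fintype.linearIndependent_iff]
  intro c hc i
  have : NeZero M := ⟨by have := hlt i; lia⟩
  have hunit (j : ι) : IsUnit (v j : ZMod M) := (ZMod.isUnit_iff_coprime _ _).mpr (hcop j)
  have hrel : ∑ j, (c j : ℂ) * zmodCot (v j : ZMod M) = 0 := by
    simp_rw [zmodCot_natCast]
    simpa [Rat.smul_def] using congrArg ((↑) : ℝ → ℂ) hc
  have hodd (χ : DirichletCharacter ℂ M) :
      ∑ j, (c j : ℂ) * (χ (v j : ZMod M)⁻¹ * χ (v i) - χ (v j : ZMod M)⁻¹ * χ (-(v i))) = 0 := by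
    rcases χ.even_or_odd with h | h
    · simp [h.to_fun (v i : ZMod M)]
    · simp_rw [← mul_sub, ← mul_assoc]
      rw [← Finset.sum_mul, sum_char_inv_eq_zero hunit hrel h, zero_mul]
  have hsum := Finset.sum_eq_zero fun χ (_ : χ ∈ Finset.univ) ↦ hodd χ
  rw [Finset.sum_comm] at hsum
  have hne (j : ι) : (v j : ZMod M) ≠ -(v i) := by
    rw [Ne, eq_neg_iff_add_eq_zero, ← Nat.cast_add, ZMod.natCast_eq_zero_iff]
    intro hdvd
    have := Nat.le_of_dvd (by have := hpos i; lia) hdvd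
    have := hlt i
    have := hlt j
    lia
  have heq (j : ι) : (v j : ZMod M) = v i ↔ j = i := by
    refine ⟨fun h ↦ hinj ?_, fun h ↦ h ▸ rfl⟩
    rw [ZMod.natCast_eq_natCast_iff'] at h
    rwa [Nat.mod_eq_of_lt (by have := hlt j; lia), Nat.mod_eq_of_lt (by have := hlt i; lia)] at h
  simp_rw [← Finset.mul_sum, Finset.sum_sub_distrib,
    DirichletCharacter.sum_char_inv_mul_char_eq ℂ (hunit _), hne, heq] at hsum
  have hφ : (M.totient : ℂ) ≠ 0 := Nat.cast_ne_zero.mpr (Nat.totient_pos.mpr (NeZero.pos M)).ne'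
  simpa [hφ] using hsum

/-- If `k` is coprime to `N`, then the reduced denominator of `1 / 2 - k / N` depends only
on `N`. -/
lemma exists_half_sub_div_eq (N : ℕ) : ∃ g M : ℕ, 0 < g ∧ g * M = 2 * N ∧
    ∀ k, 2 * k < N → k.Coprime N → ∃ v, 2 * k + g * v = N ∧ v.Coprime M := by
  rcases N.even_or_odd with heven | hodd
  · obtain ⟨m, rfl⟩ := heven.two_dvd
    have hk_odd {k : ℕ} (hk : k.Coprime (2 * m)) : Odd k :=
      (Nat.Coprime.coprime_mul_right_right hk).odd_of_right
    rcases m.even_or_odd with hm | hm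
    · refine ⟨2, 2 * m, two_pos, rfl, fun k hlt hk ↦ ⟨m - k, by lia, ?_⟩⟩
      obtain ⟨v, rfl⟩ : ∃ v, m = k + v := ⟨m - k, by lia⟩
      have hkv : k.Coprime v := by simpa using hk.coprime_mul_left_right
      have hv : Odd v := by have := hk_odd hk; grind
      rw [add_tsub_cancel_left]
      exact hv.coprime_two_right.mul_right (by simpa using hkv.symm)
    · refine ⟨4, m, four_pos, by ring, fun k hlt hk ↦ ?_⟩
      obtain ⟨v, rfl⟩ : ∃ v, m = k + 2 * v := ⟨(m - k) / 2, by have := hk_odd hk; grind⟩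
      have hkv : k.Coprime (2 * v) := by simpa using hk.coprime_mul_left_right
      exact ⟨v, by ring, by simpa using hkv.coprime_mul_left_right.symm⟩
  · refine ⟨1, 2 * N, one_pos, by ring, fun k hlt hk ↦ ?_⟩
    obtain ⟨v, rfl⟩ : ∃ v, N = 2 * k + v := ⟨N - 2 * k, by lia⟩
    have hv : v.Coprime 2 := Nat.coprime_two_right.mpr (by grind)
    have hkv : k.Coprime v := by simpa [mul_comm 2 k] using hk
    exact ⟨v, by ring, hv.mul_right (by simpa using hv.mul_right hkv.symm)⟩

lemma tan_eq_cot_of_add_eq {N M g k v : ℕ} (hN : 0 < N) (hg : 0 < g) (hM : g * M = 2 * N)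
    (hv : 2 * k + g * v = N) :
    Real.tan (k * Real.pi / N) = Real.cot (Real.pi * (v / M)) := by
  have hM' : (g * M : ℝ) = 2 * N := by exact_mod_cast hM
  have hv' : (2 * k + g * v : ℝ) = N := by exact_mod_cast hv
  have hN' : (N : ℝ) ≠ 0 := by positivity
  have hg' : (g : ℝ) ≠ 0 := by positivity
  have hM0 : (M : ℝ) ≠ 0 := by
    rintro h
    rw [h, mul_zero] at hM'
    exact hN' (by linarith)
  have hquot : (v : ℝ) / M = 1 / 2 - k / N := by
    field_simp
    apply mul_left_cancel₀ hg'
    linear_combination (2 * (N : ℝ)) * hv' - (N - 2 * k : ℝ) * hM'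
  rw [hquot, ← Real.tan_inv_eq_cot,
    show Real.pi * (1 / 2 - k / N : ℝ) = Real.pi / 2 - k * Real.pi / N by ring,
    Real.tan_pi_div_two_sub, inv_inv]

lemma linearIndependent_tan {N : ℕ} {ι : Type*} [Fintype ι] {k : ι → ℕ}
    (hinj : Function.Injective k) (hpos : ∀ i, 0 < k i) (hlt : ∀ i, 2 * k i < N)
    (hcop : ∀ i, (k i).Coprime N) :
    LinearIndependent ℚ fun i ↦ Real.tan (k i * Real.pi / N) := by
  obtain ⟨g, M, hg, hM, hex⟩ := exists_half_sub_div_eq N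
  choose v hv hvM using fun i ↦ hex (k i) (hlt i) (hcop i)
  have htan (i : ι) : Real.tan (k i * Real.pi / N) = Real.cot (Real.pi * (v i / M)) :=
    tan_eq_cot_of_add_eq (by have := hlt i; lia) hg hM (hv i)
  simp_rw [htan]
  refine linearIndependent_cot (fun i j hij ↦ hinj ?_) (fun i ↦ ?_) (fun i ↦ ?_) hvM
  · have hi := hv i
    have hj := hv j
    rw [hij] at hi
    lia
  · rcases Nat.eq_zero_or_pos (v i) with h | h
    · have := hv i
      have := hlt i
      simp_all
    · exact h
  · have h1 := hv i
    have h2 := hpos i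
    refine lt_of_mul_lt_mul_left (a := g) ?_ hg.le
    rw [hM, mul_left_comm]
    lia

lemma I_mul_tan_eq (θ : ℝ) :
    I * (Real.tan θ : ℂ) = (cexp (2 * I * θ) - 1) / (cexp (2 * I * θ) + 1) := by
  have h : Complex.tan θ = (Complex.cot θ)⁻¹ := by simp [Complex.cot, Complex.tan]
  rw [Complex.ofReal_tan, h, Complex.cot_eq_exp_ratio, inv_div, mul_div_assoc', ← mul_assoc,
    I_mul_I]
  ring

/-- Let `t` be a `ℚ`-linearly independent family of reals such that the numbers `I * t i` lie in
a number field `K` of degree at most twice the size of the family. Then `t` spans the reals `x`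
with `I * x ∈ K`. -/
lemma mem_span_range_of_I_mul_mem {ι : Type*} [Fintype ι] {t : ι → ℝ}
    (ht : LinearIndependent ℚ t) {K : IntermediateField ℚ ℂ} [FiniteDimensional ℚ K]
    (hK : Module.finrank ℚ K ≤ 2 * Fintype.card ι) (htK : ∀ i, I * t i ∈ K)
    {x : ℝ} (hx : I * x ∈ K) : x ∈ Submodule.span ℚ (Set.range t) := by
  rcases eq_or_ne x 0 with rfl | hx0
  · exact Submodule.zero_mem _
  let b : ι ⊕ ι → K := Sum.elim (fun i ↦ ⟨I * t i, htK i⟩) fun i ↦ ⟨I * x, hx⟩ * ⟨I * t i, htK i⟩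
  have hcoe (c : ι ⊕ ι → ℚ) : ((∑ i, c i • b i : K) : ℂ) =
      I * (∑ i, c (.inl i) • t i : ℝ) - x * (∑ i, c (.inr i) • t i : ℝ) := by
    rw [Fintype.sum_sum_type, sub_eq_add_neg]
    push_cast [Finset.mul_sum, ← Finset.sum_neg_distrib]
    congr 1 <;> refine Finset.sum_congr rfl fun i _ ↦ ?_
    · simp only [b, Sum.elim_inl, Rat.smul_def]
      ring
    · simp only [b, Sum.elim_inr, Rat.smul_def, MulMemClass.coe_mul]
      linear_combination (c (.inr i) * x * t i : ℂ) * I_mul_I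
  have hb : LinearIndependent ℚ b := by
    rw [Fintype.linearIndependent_iff] at ht ⊢
    intro c hc
    have h := hcoe c
    rw [hc] at h
    have him := congrArg Complex.im h
    have hre := congrArg Complex.re h
    simp only [ZeroMemClass.coe_zero, zero_im, zero_re, sub_im, sub_re, mul_im, mul_re, I_re, I_im,
      ofReal_re, ofReal_im, zero_mul, mul_zero, one_mul, add_zero, zero_add, sub_zero, sub_self,
      zero_sub] at him hre
    rintro (i | i)
    · exact ht (fun i ↦ c (.inl i)) him.symm i
    · exact ht (fun i ↦ c (.inr i)) ((mul_eq_zero.mp (neg_eq_zero.mp hre.symm)).resolve_left hx0) i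
  have hspan := hb.span_eq_top_of_card_eq_finrank'
    (le_antisymm hb.fintype_card_le_finrank (by simpa [two_mul] using hK))
  obtain ⟨c, hc⟩ := (Submodule.mem_span_range_iff_exists_fun ℚ).mp
    (hspan ▸ Submodule.mem_top : (⟨I * x, hx⟩ : K) ∈ Submodule.span ℚ (Set.range b))
  have h := hcoe c
  rw [hc] at h
  have him := congrArg Complex.im h
  refine (Submodule.mem_span_range_iff_exists_fun ℚ).mpr ⟨fun i ↦ c (.inl i), ?_⟩
  simpa using him.symm

lemma totient_le_two_mul_card {N : ℕ} (hN : 3 ≤ N) : N.totient ≤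
    2 * (Finset.filter (fun k => 1 ≤ k ∧ 2 * k < N ∧ Nat.gcd k N = 1) (Finset.range N)).card := by
  set S := Finset.filter (fun k => 1 ≤ k ∧ 2 * k < N ∧ Nat.gcd k N = 1) (Finset.range N) with hS
  rw [Nat.totient_eq_card_coprime]
  calc (Finset.filter N.Coprime (Finset.range N)).card
    _ ≤ (S ∪ S.image (N - ·)).card := Finset.card_le_card fun k hk ↦ ?_
    _ ≤ S.card + (S.image (N - ·)).card := Finset.card_union_le _ _
    _ ≤ 2 * S.card := by
        rw [two_mul]
        exact Nat.add_le_add_left Finset.card_image_le _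
  simp only [Finset.mem_filter, Finset.mem_range, Finset.mem_union, Finset.mem_image, hS] at hk ⊢
  obtain ⟨hkN, hcop⟩ := hk
  have hk0 : k ≠ 0 := by rintro rfl; simp at hcop; lia
  have h2 : 2 * k ≠ N := by
    rintro rfl
    have : k = 1 := hcop.symm.eq_one_of_dvd (dvd_mul_left k 2)
    lia
  rcases lt_or_gt_of_ne h2 with h | h
  · exact .inl ⟨hkN, by lia, h, hcop.symm⟩
  · refine .inr ⟨N - k, ⟨by lia, by lia, by lia, ?_⟩, by lia⟩
    exact (Nat.coprime_self_sub_left hkN.le).mpr hcop.symm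

/-- Complexity of dual scales: for `N ≥ 3`, (i) the primitive dual scales
`tan(kπ/N)/tan(π/N)` with `1 ≤ k < N/2`, `gcd(k, N) = 1` are linearly
independent over `ℚ`; (ii) every dual scale `tan(jπ/N)/tan(π/N)` with
`1 ≤ j < N/2` lies in their `ℚ`-linear span. -/
theorem primitive_dual_scales_basis
    (N : ℕ) (hN : 3 ≤ N) :
    (∀ a : ℕ → ℚ,
      (∑ k ∈ Finset.filter (fun k => 1 ≤ k ∧ 2 * k < N ∧ Nat.gcd k N = 1) (Finset.range N),
          (a k : ℝ) * (Real.tan (k * Real.pi / N) / Real.tan (Real.pi / N)) = 0) →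
        ∀ k : ℕ, 1 ≤ k → 2 * k < N → Nat.gcd k N = 1 → a k = 0) ∧
    (∀ j : ℕ, 1 ≤ j → 2 * j < N →
      Real.tan (j * Real.pi / N) / Real.tan (Real.pi / N) ∈
        Submodule.span ℚ
          {x : ℝ | ∃ k : ℕ, 1 ≤ k ∧ 2 * k < N ∧ Nat.gcd k N = 1 ∧
            x = Real.tan (k * Real.pi / N) / Real.tan (Real.pi / N)}) := by
  set S := Finset.filter (fun k => 1 ≤ k ∧ 2 * k < N ∧ Nat.gcd k N = 1) (Finset.range N)
  have hS (k : S) : 1 ≤ (k : ℕ) ∧ 2 * (k : ℕ) < N ∧ Nat.gcd k N = 1 :=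
    (Finset.mem_filter.mp k.2).2
  have hN0 : (0 : ℝ) < N := by positivity
  have htan : Real.tan (Real.pi / N) ≠ 0 := by
    refine (Real.tan_pos_of_pos_of_lt_pi_div_two (by positivity) ?_).ne'
    have : (3 : ℝ) ≤ N := by exact_mod_cast hN
    exact div_lt_div_of_pos_left Real.pi_pos two_pos (by linarith)
  have hli : LinearIndependent ℚ fun k : S ↦ Real.tan ((k : ℕ) * Real.pi / N) :=
    linearIndependent_tan Subtype.val_injective (fun k ↦ (hS k).1) (fun k ↦ (hS k).2.1)
      fun k ↦ (hS k).2.2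
  refine ⟨fun a ha k hk1 hk2 hk3 ↦ ?_, fun j hj1 hj2 ↦ ?_⟩
  · refine Fintype.linearIndependent_iff.mp hli (fun k ↦ a k) ?_
      ⟨k, Finset.mem_filter.mpr ⟨Finset.mem_range.mpr (by lia), hk1, hk2, hk3⟩⟩
    simp_rw [← mul_div_assoc, ← Finset.sum_div] at ha
    rw [Finset.sum_coe_sort S fun k ↦ a k • Real.tan (k * Real.pi / N)]
    simpa [Rat.smul_def] using (div_eq_zero_iff.mp ha).resolve_right htan
  · set ζ : ℂ := cexp (2 * Real.pi * I / N) with hζ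
    have hprim : IsPrimitiveRoot ζ N := Complex.isPrimitiveRoot_exp N (by lia)
    have hint : IsIntegral ℚ ζ := (hprim.isIntegral (by lia)).tower_top
    have hmem (k : ℕ) : I * Real.tan (k * Real.pi / N) ∈ IntermediateField.adjoin ℚ {ζ} := by
      have hexp : cexp (2 * I * (k * Real.pi / N : ℝ)) = ζ ^ k := by
        rw [hζ, ← Complex.exp_nat_mul]
        push_cast
        ring_nf
      have hζK := pow_mem (IntermediateField.mem_adjoin_simple_self ℚ ζ) k
      rw [I_mul_tan_eq, hexp]
      exact div_mem (sub_mem hζK (one_mem _)) (add_mem hζK (one_mem _))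
    have : FiniteDimensional ℚ (IntermediateField.adjoin ℚ {ζ}) :=
      IntermediateField.adjoin.finiteDimensional hint
    have hspan := mem_span_range_of_I_mul_mem hli (K := IntermediateField.adjoin ℚ {ζ})
      (by
        rw [IntermediateField.adjoin.finrank hint,
          ← Polynomial.cyclotomic_eq_minpoly_rat hprim (by lia),
          Polynomial.natDegree_cyclotomic, Fintype.card_coe]
        exact totient_le_two_mul_card hN)
      (fun k ↦ hmem k) (hmem j)
    obtain ⟨c, hc⟩ := (Submodule.mem_span_range_iff_exists_fun ℚ).mp hspan
    rw [← hc, Finset.sum_div]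
    refine Submodule.sum_mem _ fun k _ ↦ ?_
    rw [smul_div_assoc]
    exact Submodule.smul_mem _ _ (Submodule.subset_span ⟨k, (hS k).1, (hS k).2.1, (hS k).2.2, rfl⟩)
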